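/- Let 1 ≤ s < ∞. There exists a 2×2 matrix weight W on ℝ with [W]_{A_{s,∞},𝒟} = ∞ such that [W]_{A_{t,∞}} < ∞ for all s < t < ∞. -/

import Mathlib

open MeasureTheory ENNReal
open scoped ComplexOrder

noncomputable section

/-- The power `A^a` of a matrix, defined via the continuous functional calculus
(for positive definite Hermitian matrices this diagonalizes `A` and raises the
eigenvalues to the `a`-th power). -/
def matRpow {d : ℕ} (A : Matrix (Fin d) (Fin d) ℂ) (a : ℝ) : Matrix (Fin d) (Fin d) ℂ :=
  cfc (fun x : ℝ => x ^ a) A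

/-- The spectral norm (largest singular value) of a matrix, i.e. its norm as an operator
on the Euclidean space `ℂ^d`. -/
def specNorm {d : ℕ} (A : Matrix (Fin d) (Fin d) ℂ) : ℝ :=
  ‖Matrix.toEuclideanCLM (𝕜 := ℂ) A‖

/-- Hölder conjugate exponent. -/
def conjExp (p : ℝ) : ℝ := p / (p - 1)

/-- The Lebesgue average `⨍_Q f dμ` of an `ℝ≥0∞`-valued function. -/
def lavg {α : Type*} [MeasurableSpace α] (μ : Measure α) (Q : Set α) (f : α → ℝ≥0∞) : ℝ≥0∞ :=
  (μ Q)⁻¹ * ∫⁻ x in Q, f x ∂μ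

/-- The two-exponent matrix Muckenhoupt characteristic `[W]_{A_{p,q}}`, with the supremum
taken over a family `S` of sets. -/
def matApq {α : Type*} [MeasurableSpace α] {d : ℕ} (μ : Measure α) (S : Set (Set α))
    (W : α → Matrix (Fin d) (Fin d) ℂ) (p q : ℝ) : ℝ≥0∞ :=
  ⨆ Q ∈ S, lavg μ Q fun x =>
    (lavg μ Q fun y =>
        ENNReal.ofReal (specNorm (matRpow (W x) (1 / q) * matRpow (W y) (-(1 / q))))
          ^ conjExp p) ^ (q / conjExp p)

/-- The endpoint matrix Muckenhoupt characteristic `[W]_{A_{t,∞}}`, with the supremum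
taken over a family `S` of sets. -/
def matAtInfty {α : Type*} [MeasurableSpace α] {d : ℕ} (μ : Measure α) (S : Set (Set α))
    (W : α → Matrix (Fin d) (Fin d) ℂ) (t : ℝ) : ℝ≥0∞ :=
  ⨆ Q ∈ S, essSup (fun x =>
    lavg μ Q fun y =>
      ENNReal.ofReal (specNorm (matRpow (W x) (1 / t) * matRpow (W y) (-(1 / t)))) ^ t)
    (μ.restrict Q)

/-- The scalar reverse Hölder characteristic `[w]_{RH_s}`, with the supremum taken over a
family `S` of sets. -/
def scalRH {α : Type*} [MeasurableSpace α] (μ : Measure α) (S : Set (Set α))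
    (w : α → ℝ) (s : ℝ) : ℝ≥0∞ :=
  ⨆ Q ∈ S, (lavg μ Q fun x => ENNReal.ofReal (w x) ^ s) ^ (1 / s) /
    lavg μ Q fun x => ENNReal.ofReal (w x)

/-- The scalar reverse Hölder characteristic `[w]_{RH_∞}`, with the supremum taken over a
family `S` of sets. -/
def scalRHInfty {α : Type*} [MeasurableSpace α] (μ : Measure α) (S : Set (Set α))
    (w : α → ℝ) : ℝ≥0∞ :=
  ⨆ Q ∈ S, essSup (fun x => ENNReal.ofReal (w x)) (μ.restrict Q) /
    lavg μ Q fun x => ENNReal.ofReal (w x)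

/-- The matrix reverse Hölder characteristic `[W]_{RH_{t,s}}`. -/
def matRH {α : Type*} [MeasurableSpace α] {d : ℕ} (μ : Measure α) (S : Set (Set α))
    (W : α → Matrix (Fin d) (Fin d) ℂ) (t s : ℝ) : ℝ≥0∞ :=
  ⨆ (e : EuclideanSpace ℂ (Fin d)) (_ : e ≠ 0),
    scalRH μ S (fun x => ‖Matrix.toEuclideanCLM (𝕜 := ℂ) (matRpow (W x) (1 / t)) e‖ ^ t) s

/-- The matrix reverse Hölder characteristic `[W]_{RH_{t,∞}}`. -/
def matRHInfty {α : Type*} [MeasurableSpace α] {d : ℕ} (μ : Measure α) (S : Set (Set α))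
    (W : α → Matrix (Fin d) (Fin d) ℂ) (t : ℝ) : ℝ≥0∞ :=
  ⨆ (e : EuclideanSpace ℂ (Fin d)) (_ : e ≠ 0),
    scalRHInfty μ S (fun x => ‖Matrix.toEuclideanCLM (𝕜 := ℂ) (matRpow (W x) (1 / t)) e‖ ^ t)

/-- An axis-parallel cube in `ℝ^n` with corner `c` and positive side length `h`. -/
def cube {n : ℕ} (c : Fin n → ℝ) (h : ℝ) : Set (Fin n → ℝ) :=
  {x | ∀ i, x i ∈ Set.Ico (c i) (c i + h)}

/-- The family of all axis-parallel cubes in `ℝ^n`. -/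
def cubes (n : ℕ) : Set (Set (Fin n → ℝ)) :=
  {Q | ∃ (c : Fin n → ℝ) (h : ℝ), 0 < h ∧ Q = cube c h}

/-- The family of all (left-closed right-open, nontrivial, bounded) intervals in `ℝ`,
i.e. the axis-parallel "cubes" of `ℝ^1`. -/
def intervalsR : Set (Set ℝ) := {I | ∃ a b : ℝ, a < b ∧ I = Set.Ico a b}

/-- The family of all dyadic intervals `[m·2^k, (m+1)·2^k)`, `m, k ∈ ℤ`, in `ℝ`. -/
def dyadicsR : Set (Set ℝ) :=
  {I | ∃ m k : ℤ, I = Set.Ico ((m : ℝ) * 2 ^ k) (((m : ℝ) + 1) * 2 ^ k)}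

/-- A `d×d` matrix weight: a locally integrable matrix-valued function whose values are
a.e. positive definite (Hermitian). -/
def IsMatrixWeight {α : Type*} [MeasurableSpace α] [TopologicalSpace α] {d : ℕ}
    (μ : Measure α) (W : α → Matrix (Fin d) (Fin d) ℂ) : Prop :=
  (∀ i j, LocallyIntegrable (fun x => W x i j) μ) ∧ ∀ᵐ x ∂μ, (W x).PosDef

/-- The real symmetric matrix `1 + (l - 1) P`, where `P` is the orthogonal projection onto the
line spanned by the unit vector `(c, u)`. -/
def stretch (l c u : ℝ) : Matrix (Fin 2) (Fin 2) ℝ :=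
  !![1 + (l - 1) * c ^ 2, (l - 1) * (c * u); (l - 1) * (c * u), 1 + (l - 1) * u ^ 2]

/-- The complex matrix underlying `stretch`. -/
def cstretch (l c u : ℝ) : Matrix (Fin 2) (Fin 2) ℂ :=
  (stretch l c u).map Complex.ofReal

lemma cstretch_posDef {l c u : ℝ} (hl : 0 < l) (hl1 : l ≤ 1) (h : c ^ 2 + u ^ 2 = 1) :
    (cstretch l c u).PosDef := by
  have e : cstretch l c u = (l : ℂ) • (1 : Matrix (Fin 2) (Fin 2) ℂ) +
      ((1 - l : ℝ) : ℂ) • Matrix.vecMulVec ![(-u : ℂ), (c : ℂ)] (star ![(-u : ℂ), (c : ℂ)]) := by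
    have h' : (c : ℂ) ^ 2 + (u : ℂ) ^ 2 = 1 := by exact_mod_cast h
    ext i j
    rw [Matrix.add_apply, Matrix.smul_apply, Matrix.smul_apply, Matrix.vecMulVec_apply]
    fin_cases i <;> fin_cases j <;> simp [cstretch, stretch]
    · linear_combination (l - 1 : ℂ) * h'
    · ring
    · ring
    · linear_combination (l - 1 : ℂ) * h'
  rw [e]
  refine Matrix.PosDef.add_posSemidef ?_ ?_
  · exact Matrix.PosDef.smul Matrix.PosDef.one (by exact_mod_cast hl)
  · exact Matrix.PosSemidef.smul (Matrix.posSemidef_vecMulVec_self_star _)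
      (by exact_mod_cast sub_nonneg.2 hl1)

lemma matRpow_cstretch {l c u : ℝ} (hl : 0 < l) (hl1 : l ≤ 1) (h : c ^ 2 + u ^ 2 = 1) (a : ℝ) :
    matRpow (cstretch l c u) a = cstretch (l ^ a) c u := by
  have hsa : IsSelfAdjoint (cstretch l c u) := (cstretch_posDef hl hl1 h).isHermitian
  have h' : (c : ℂ) ^ 2 + (u : ℂ) ^ 2 = 1 := by exact_mod_cast h
  have hspec : ∀ z ∈ spectrum ℝ (cstretch l c u), z = 1 ∨ z = l := by
    intro z hz
    by_contra! hne
    refine hz ?_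
    have hd : ((z : ℂ) - 1) * (z - l) ≠ 0 := by
      refine mul_ne_zero ?_ ?_
      · exact_mod_cast sub_ne_zero.2 hne.1
      · exact_mod_cast sub_ne_zero.2 hne.2
    rw [spectrum.mem_resolventSet_iff, Matrix.isUnit_iff_isUnit_det, isUnit_iff_ne_zero]
    convert hd using 1
    rw [Matrix.det_fin_two]
    simp [cstretch, stretch, Matrix.algebraMap_matrix_apply]
    linear_combination (l - 1 : ℂ) * (1 - z) * h'
  have hcongr : (spectrum ℝ (cstretch l c u)).EqOn (fun x : ℝ => x ^ a)
      (fun x : ℝ => (1 - (l ^ a - 1) / (l - 1)) + (l ^ a - 1) / (l - 1) * x) := by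
    intro z hz
    rcases hspec z hz with rfl | rfl
    · simp
    · by_cases h1 : z = 1
      · subst h1; simp
      · have : z - 1 ≠ 0 := sub_ne_zero.2 h1
        field_simp
        ring
  have hk : (l ^ a - 1) / (l - 1) * (l - 1) = l ^ a - 1 := by
    by_cases h1 : l = 1
    · subst h1; simp
    · exact div_mul_cancel₀ _ (sub_ne_zero.2 h1)
  rw [matRpow, cfc_congr hcongr, cfc_const_add _ _ _, cfc_const_mul_id _ _ hsa]
  generalize (l ^ a - 1) / (l - 1) = k at hk
  rw [cstretch, cstretch, stretch, stretch, ← hk]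
  ext i j
  fin_cases i <;> fin_cases j <;>
    simp [Matrix.algebraMap_matrix_apply] <;> ring

lemma specNorm_nonneg {d : ℕ} (A : Matrix (Fin d) (Fin d) ℂ) : 0 ≤ specNorm A :=
  norm_nonneg _

lemma specNorm_map_ofReal_le {B : Matrix (Fin 2) (Fin 2) ℝ} {m : ℝ} (hm : 0 ≤ m)
    (hB : ∀ i j, |B i j| ≤ m) : specNorm (B.map Complex.ofReal) ≤ 4 * m := by
  refine ContinuousLinearMap.opNorm_le_bound _ (by positivity) fun x => ?_
  have hx : ∀ i, ‖x i‖ ≤ ‖x‖ := fun i => PiLp.norm_apply_le x i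
  have hc : ∀ i, ‖(Matrix.toEuclideanCLM (𝕜 := ℂ) (B.map Complex.ofReal) x) i‖
      ≤ 2 * m * ‖x‖ := by
    intro i
    change ‖(B.map Complex.ofReal).mulVec x.ofLp i‖ ≤ _
    rw [Matrix.mulVec, dotProduct, Fin.sum_univ_two]
    refine (norm_add_le _ _).trans ?_
    simp only [norm_mul, Matrix.map_apply, Complex.norm_real, Real.norm_eq_abs]
    have h0 := mul_le_mul (hB i 0) (hx 0) (norm_nonneg _) hm
    have h1 := mul_le_mul (hB i 1) (hx 1) (norm_nonneg _) hm
    linarith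
  rw [EuclideanSpace.norm_eq, Fin.sum_univ_two]
  refine Real.sqrt_le_iff.2 ⟨by positivity, ?_⟩
  have h0 := pow_le_pow_left₀ (norm_nonneg _) (hc 0) 2
  have h1 := pow_le_pow_left₀ (norm_nonneg _) (hc 1) 2
  nlinarith [sq_nonneg (m * ‖x‖)]

lemma abs_bilin_le_specNorm (B : Matrix (Fin 2) (Fin 2) ℝ) {e f : Fin 2 → ℝ}
    (he : e 0 ^ 2 + e 1 ^ 2 = 1) (hf : f 0 ^ 2 + f 1 ^ 2 = 1) :
    |e 0 * (B 0 0 * f 0 + B 0 1 * f 1) + e 1 * (B 1 0 * f 0 + B 1 1 * f 1)|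
      ≤ specNorm (B.map Complex.ofReal) := by
  have hnorm : ∀ g : Fin 2 → ℝ, g 0 ^ 2 + g 1 ^ 2 = 1 →
      ‖(WithLp.toLp 2 fun i => (g i : ℂ) : EuclideanSpace ℂ (Fin 2))‖ = 1 := by
    intro g hg
    rw [EuclideanSpace.norm_eq, Fin.sum_univ_two]
    simp [hg]
  have key := (norm_inner_le_norm (𝕜 := ℂ)
    (WithLp.toLp 2 fun i => (e i : ℂ) : EuclideanSpace ℂ (Fin 2))
    (Matrix.toEuclideanCLM (𝕜 := ℂ) (B.map Complex.ofReal)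
      (WithLp.toLp 2 fun i => (f i : ℂ)))).trans
    (mul_le_mul_of_nonneg_left (ContinuousLinearMap.le_opNorm _ _) (norm_nonneg _))
  rw [hnorm e he, hnorm f hf, one_mul, mul_one, Matrix.toEuclideanCLM_toLp] at key
  refine le_trans (le_of_eq ?_) key
  rw [← Real.norm_eq_abs, ← Complex.norm_real]
  congr 1
  simp [PiLp.inner_apply, Fin.sum_univ_two]
  ring

lemma cstretch_mul_cstretch (l c u l' c' u' : ℝ) :
    cstretch l c u * cstretch l' c' u' =
      (stretch l c u * stretch l' c' u').map Complex.ofReal := by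
  rw [cstretch, cstretch]
  exact (Matrix.map_mul (f := Complex.ofRealHom)).symm

/-- The scalar `A₁` weight `1 + |x| ^ (-1/2)`. -/
def singWeight (x : ℝ) : ℝ := 1 + (√|x|)⁻¹

/-- The sine of the angle by which the eigenvectors of the matrix weight are rotated. -/
def tilt (s x : ℝ) : ℝ := ((1 + Real.log (singWeight x)) / singWeight x) ^ (1 / s)

/-- The matrix weight with eigenvalues `1` and `(singWeight x)⁻¹`, the latter on the line
spanned by the unit vector with second coordinate `tilt s x`. -/
def tiltedWeight (s x : ℝ) : Matrix (Fin 2) (Fin 2) ℂ :=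
  cstretch (singWeight x)⁻¹ (√(1 - tilt s x ^ 2)) (tilt s x)

lemma one_le_singWeight (x : ℝ) : 1 ≤ singWeight x := by
  have : 0 ≤ (√|x|)⁻¹ := by positivity
  unfold singWeight; linarith

lemma singWeight_pos (x : ℝ) : 0 < singWeight x := one_pos.trans_le (one_le_singWeight x)

lemma log_singWeight_nonneg (x : ℝ) : 0 ≤ Real.log (singWeight x) :=
  Real.log_nonneg (one_le_singWeight x)

lemma tilt_nonneg (s x : ℝ) : 0 ≤ tilt s x := by
  have h1 := log_singWeight_nonneg x
  have h2 := singWeight_pos x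
  unfold tilt; positivity

lemma tilt_le_one {s : ℝ} (hs : 1 ≤ s) (x : ℝ) : tilt s x ≤ 1 := by
  have h1 := log_singWeight_nonneg x
  have h2 := singWeight_pos x
  refine Real.rpow_le_one (by positivity) ?_ (by positivity)
  rw [div_le_one h2]
  linarith [Real.log_le_sub_one_of_pos h2]

lemma singWeight_mul_tilt_rpow {s : ℝ} (hs : 1 ≤ s) (x : ℝ) :
    singWeight x * tilt s x ^ s = 1 + Real.log (singWeight x) := by
  have h1 := log_singWeight_nonneg x
  have h2 := singWeight_pos x
  rw [tilt, ← Real.rpow_mul (by positivity), one_div_mul_cancel (by positivity), Real.rpow_one]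
  field_simp

lemma cos_sq_add_tilt_sq {s : ℝ} (hs : 1 ≤ s) (x : ℝ) :
    √(1 - tilt s x ^ 2) ^ 2 + tilt s x ^ 2 = 1 := by
  rw [Real.sq_sqrt] <;> nlinarith [tilt_nonneg s x, tilt_le_one hs x]

lemma exists_tilt_le {s t : ℝ} (hs : 1 ≤ s) (hst : s < t) :
    ∃ C : ℝ, 0 ≤ C ∧ ∀ x, tilt s x * singWeight x ^ (1 / t) ≤ C := by
  have hs0 : 0 < s := by linarith
  have ht0 : 0 < t := by linarith
  set ε : ℝ := 1 - s / t with hε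
  have hε0 : 0 < ε := by rw [hε, sub_pos, div_lt_one ht0]; exact hst
  refine ⟨(1 / ε + 1) ^ (1 / s), by positivity, fun x => ?_⟩
  have h1 := log_singWeight_nonneg x
  have h2 := singWeight_pos x
  have hlog := Real.log_le_rpow_div h2.le hε0
  have hone : 1 ≤ singWeight x ^ ε := Real.one_le_rpow (one_le_singWeight x) hε0.le
  have hb : (1 + Real.log (singWeight x)) / singWeight x
      ≤ (1 / ε + 1) * singWeight x ^ (ε - 1) := by
    rw [Real.rpow_sub_one h2.ne', ← mul_div_assoc]
    gcongr
    rw [add_mul, one_mul, one_div_mul_eq_div]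
    linarith
  calc tilt s x * singWeight x ^ (1 / t)
      ≤ ((1 / ε + 1) * singWeight x ^ (ε - 1)) ^ (1 / s) * singWeight x ^ (1 / t) := by
        unfold tilt; gcongr
    _ = (1 / ε + 1) ^ (1 / s) * (singWeight x ^ ((ε - 1) * (1 / s) + 1 / t)) := by
        rw [Real.mul_rpow (by positivity) (by positivity), ← Real.rpow_mul h2.le, mul_assoc,
          ← Real.rpow_add h2]
    _ = (1 / ε + 1) ^ (1 / s) := by
        have : (ε - 1) * (1 / s) + 1 / t = 0 := by rw [hε]; field_simp; ring
        rw [this, Real.rpow_zero, mul_one]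

lemma measurable_singWeight : Measurable singWeight := by
  unfold singWeight
  exact measurable_const.add (Real.continuous_sqrt.measurable.comp measurable_norm).inv

lemma measurable_tilt (s : ℝ) : Measurable (tilt s) := by
  unfold tilt
  exact (((Real.measurable_log.comp measurable_singWeight).const_add 1).div
    measurable_singWeight).pow_const _

lemma stretch_eq {c u : ℝ} (h : c ^ 2 + u ^ 2 = 1) (l : ℝ) :
    stretch l c u = !![u ^ 2 + l * c ^ 2, (l - 1) * (c * u);
      (l - 1) * (c * u), c ^ 2 + l * u ^ 2] := by
  have e1 : 1 + (l - 1) * c ^ 2 = u ^ 2 + l * c ^ 2 := by linear_combination -h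
  have e2 : 1 + (l - 1) * u ^ 2 = c ^ 2 + l * u ^ 2 := by linear_combination -h
  rw [stretch, e1, e2]

lemma abs_stretch_le {c u l : ℝ} (h : c ^ 2 + u ^ 2 = 1) (hl : 0 ≤ l) (hl1 : l ≤ 1)
    (i j : Fin 2) : |stretch l c u i j| ≤ 1 := by
  have h1 := mul_nonneg (sub_nonneg.2 hl1) (sq_nonneg (c + u))
  have h2 := mul_nonneg (sub_nonneg.2 hl1) (sq_nonneg (c - u))
  have h3 := mul_nonneg (sub_nonneg.2 hl1) (sq_nonneg c)
  have h4 := mul_nonneg (sub_nonneg.2 hl1) (sq_nonneg u)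
  rw [stretch, abs_le]
  fin_cases i <;> fin_cases j <;> simp <;> constructor <;> nlinarith

lemma isMatrixWeight_tiltedWeight {s : ℝ} (hs : 1 ≤ s) :
    IsMatrixWeight (volume : Measure ℝ) (tiltedWeight s) := by
  refine ⟨fun i j => ?_, ae_of_all _ fun x => ?_⟩
  · refine (locallyIntegrable_const (1 : ℝ)).mono ?_ (ae_of_all _ fun x => ?_)
    · refine Measurable.aestronglyMeasurable ?_
      have hv := measurable_singWeight
      have hu := measurable_tilt s
      have hc : Measurable fun x => √(1 - tilt s x ^ 2) :=
        Real.continuous_sqrt.measurable.comp ((hu.pow_const 2).const_sub 1)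
      refine Complex.measurable_ofReal.comp
        (f := fun x => stretch (singWeight x)⁻¹ (√(1 - tilt s x ^ 2)) (tilt s x) i j) ?_
      fin_cases i <;> fin_cases j <;> simp [stretch] <;> fun_prop
    · rw [tiltedWeight, cstretch, Matrix.map_apply, Complex.norm_real, norm_one, Real.norm_eq_abs]
      exact abs_stretch_le (cos_sq_add_tilt_sq hs x) (inv_nonneg.2 (singWeight_pos x).le)
        (inv_le_one_of_one_le₀ (one_le_singWeight x)) i j
  · exact cstretch_posDef (inv_pos.2 (singWeight_pos x))
      (inv_le_one_of_one_le₀ (one_le_singWeight x)) (cos_sq_add_tilt_sq hs x)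

lemma matRpow_tiltedWeight_mul {s : ℝ} (hs : 1 ≤ s) (t x y : ℝ) :
    matRpow (tiltedWeight s x) (1 / t) * matRpow (tiltedWeight s y) (-(1 / t)) =
      (stretch (singWeight x ^ (1 / t))⁻¹ (√(1 - tilt s x ^ 2)) (tilt s x) *
        stretch (singWeight y ^ (1 / t)) (√(1 - tilt s y ^ 2)) (tilt s y)).map
          Complex.ofReal := by
  rw [tiltedWeight, tiltedWeight, matRpow_cstretch, matRpow_cstretch, cstretch_mul_cstretch,
    Real.inv_rpow (singWeight_pos x).le, Real.inv_rpow (singWeight_pos y).le,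
    Real.rpow_neg (singWeight_pos y).le, inv_inv]
  all_goals first
    | exact cos_sq_add_tilt_sq hs _
    | exact inv_pos.2 (singWeight_pos _)
    | exact inv_le_one_of_one_le₀ (one_le_singWeight _)

lemma abs_stretch_mul_stretch_le {a b c u c' u' : ℝ} (ha : 0 ≤ a) (ha1 : a ≤ 1) (hb : 0 ≤ b)
    (h : c ^ 2 + u ^ 2 = 1) (h' : c' ^ 2 + u' ^ 2 = 1) (i j : Fin 2) :
    |(stretch a c u * stretch b c' u') i j| ≤ 2 + b * (|u| + |u'|) + a * b := by
  have hc : |c| ≤ 1 := abs_le_one_iff_mul_self_le_one.2 (by nlinarith)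
  have hu : |u| ≤ 1 := abs_le_one_iff_mul_self_le_one.2 (by nlinarith)
  have hc' : |c'| ≤ 1 := abs_le_one_iff_mul_self_le_one.2 (by nlinarith)
  have hu' : |u'| ≤ 1 := abs_le_one_iff_mul_self_le_one.2 (by nlinarith)
  have hid : (c * c' + u * u') ^ 2 + (c * u' - u * c') ^ 2 = 1 := by
    linear_combination (c' ^ 2 + u' ^ 2) * h + h'
  have hD : |c * c' + u * u'| ≤ 1 :=
    abs_le_one_iff_mul_self_le_one.2 (by nlinarith [sq_nonneg (c * u' - u * c')])
  have hS : |c * u' - u * c'| ≤ 1 :=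
    abs_le_one_iff_mul_self_le_one.2 (by nlinarith [sq_nonneg (c * c' + u * u')])
  have hS' : |c * u' - u * c'| ≤ |u| + |u'| := by
    refine (abs_sub _ _).trans ?_
    rw [abs_mul, abs_mul]
    nlinarith [abs_nonneg u, abs_nonneg u']
  have key : ∀ p q p' q' : ℝ, |p| ≤ 1 → |q| ≤ 1 → |p'| ≤ 1 → |q'| ≤ 1 →
      |(c * c' + u * u') * (p * p') + b * ((c * u' - u * c') * (p * q'))
        - a * ((c * u' - u * c') * (q * p')) + a * b * ((c * c' + u * u') * (q * q'))|
      ≤ 2 + b * (|u| + |u'|) + a * b := by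
    intro p q p' q' hp hq hp' hq'
    have m : ∀ {X k l Y : ℝ}, |X| ≤ Y → |k| ≤ 1 → |l| ≤ 1 → |X * (k * l)| ≤ Y := by
      intro X k l Y hX hk hl
      rw [abs_mul, abs_mul]
      exact (mul_le_of_le_one_right (abs_nonneg _)
        (mul_le_one₀ hk (abs_nonneg _) hl)).trans hX
    have m1 := abs_le.1 (m hD hp hp')
    have m2 := abs_le.1 (m hS' hp hq')
    have m3 := abs_le.1 (m hS hq hp')
    have m4 := abs_le.1 (m hD hq hq')
    generalize (c * c' + u * u') * (p * p') = k1 at *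
    generalize (c * u' - u * c') * (p * q') = k2 at *
    generalize (c * u' - u * c') * (q * p') = k3 at *
    generalize (c * c' + u * u') * (q * q') = k4 at *
    have hab := mul_nonneg ha hb
    rw [abs_le]
    constructor <;> nlinarith
  rw [stretch_eq h, stretch_eq h']
  fin_cases i <;> fin_cases j
  · convert key (-u) c (-u') c' (by simpa) hc (by simpa) hc' using 2
    simp [Matrix.mul_apply, Fin.sum_univ_two]; ring
  · convert key (-u) c c' u' (by simpa) hc hc' hu' using 2
    simp [Matrix.mul_apply, Fin.sum_univ_two]; ring
  · convert key c u (-u') c' hc hu (by simpa) hc' using 2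
    simp [Matrix.mul_apply, Fin.sum_univ_two]; ring
  · convert key c u c' u' hc hu hc' hu' using 2
    simp [Matrix.mul_apply, Fin.sum_univ_two]; ring

lemma exists_specNorm_rpow_le {s t : ℝ} (hs : 1 ≤ s) (hst : s < t) :
    ∃ K : ℝ, 0 ≤ K ∧ ∀ x y,
      specNorm (matRpow (tiltedWeight s x) (1 / t) * matRpow (tiltedWeight s y) (-(1 / t))) ^ t
        ≤ K * (1 + singWeight y / singWeight x) := by
  obtain ⟨C, hC0, hC⟩ := exists_tilt_le hs hst
  have ht0 : 0 < t := by linarith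
  refine ⟨(4 * (2 + C)) ^ t * 2 ^ t, by positivity, fun x y => ?_⟩
  have hx := singWeight_pos x
  have hy := singWeight_pos y
  set α := singWeight x ^ (1 / t) with hα
  set b := singWeight y ^ (1 / t) with hb
  have hα1 : 1 ≤ α := Real.one_le_rpow (one_le_singWeight x) (by positivity)
  have hα0 : 0 < α := by positivity
  have hb0 : 0 < b := by positivity
  set r := α⁻¹ * b with hr
  have hr0 : 0 < r := by positivity
  have hbound : 2 + b * (|tilt s x| + |tilt s y|) + α⁻¹ * b ≤ (2 + C) * (1 + r) := by
    rw [abs_of_nonneg (tilt_nonneg s x), abs_of_nonneg (tilt_nonneg s y)]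
    have h1 : b * tilt s x ≤ C * r := by
      have : tilt s x ≤ C * α⁻¹ := by
        rw [← div_eq_mul_inv, le_div_iff₀ hα0]; exact hC x
      calc b * tilt s x ≤ b * (C * α⁻¹) := by gcongr
        _ = C * r := by rw [hr]; ring
    have h2 : b * tilt s y ≤ C := by rw [mul_comm]; exact hC y
    nlinarith
  have hnorm : specNorm (matRpow (tiltedWeight s x) (1 / t) *
      matRpow (tiltedWeight s y) (-(1 / t))) ≤ 4 * (2 + C) * (1 + r) := by
    rw [matRpow_tiltedWeight_mul hs, mul_assoc]
    exact specNorm_map_ofReal_le (by positivity) fun i j =>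
      (abs_stretch_mul_stretch_le (by positivity) (inv_le_one_of_one_le₀ hα1) hb0.le
        (cos_sq_add_tilt_sq hs x) (cos_sq_add_tilt_sq hs y) i j).trans hbound
  have hrt : r ^ t = singWeight y / singWeight x := by
    rw [hr, Real.mul_rpow (by positivity) hb0.le, Real.inv_rpow hα0.le, hα, hb,
      ← Real.rpow_mul hx.le, ← Real.rpow_mul hy.le, one_div_mul_cancel ht0.ne', Real.rpow_one,
      Real.rpow_one]
    ring
  have hpow : (1 + r) ^ t ≤ 2 ^ t * (1 + r ^ t) := by
    have hrt0 : 0 < r ^ t := by positivity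
    rcases le_total r 1 with h | h
    · calc (1 + r) ^ t ≤ 2 ^ t := by gcongr; linarith
        _ ≤ 2 ^ t * (1 + r ^ t) := le_mul_of_one_le_right (by positivity) (by linarith)
    · calc (1 + r) ^ t ≤ (2 * r) ^ t := by gcongr; linarith
        _ = 2 ^ t * r ^ t := Real.mul_rpow (by norm_num) hr0.le
        _ ≤ 2 ^ t * (1 + r ^ t) := by gcongr; linarith
  rw [← hrt, mul_assoc]
  calc specNorm _ ^ t ≤ (4 * (2 + C) * (1 + r)) ^ t :=
        Real.rpow_le_rpow (specNorm_nonneg _) hnorm ht0.le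
    _ = (4 * (2 + C)) ^ t * (1 + r) ^ t := Real.mul_rpow (by positivity) (by positivity)
    _ ≤ _ := by gcongr

lemma lintegral_Ioc_inv_sqrt {M : ℝ} (hM : 0 ≤ M) :
    ∫⁻ y in Set.Ioc 0 M, ENNReal.ofReal (√|y|)⁻¹ = ENNReal.ofReal (2 * √M) := by
  have hr : (-1 : ℝ) < -(1 / 2) := by norm_num
  have hint := (intervalIntegral.intervalIntegrable_rpow' (a := 0) (b := M) hr).1
  have hcongr : ∀ y ∈ Set.Ioc 0 M, ENNReal.ofReal (√|y|)⁻¹ =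
      ENNReal.ofReal (y ^ (-(1 / 2) : ℝ)) := by
    intro y hy
    rw [abs_of_pos hy.1, Real.rpow_neg hy.1.le, Real.sqrt_eq_rpow]
  rw [setLIntegral_congr_fun measurableSet_Ioc hcongr, ← ofReal_integral_eq_lintegral_ofReal hint,
    ← intervalIntegral.integral_of_le hM, integral_rpow (Or.inl hr)]
  · congr 1
    rw [Real.sqrt_eq_rpow, show (-(1 / 2) + 1 : ℝ) = 1 / 2 by norm_num,
      Real.zero_rpow (by norm_num)]
    ring
  · exact (ae_restrict_iff' measurableSet_Ioc).2
      (ae_of_all _ fun y hy => Real.rpow_nonneg hy.1.le _)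

lemma lintegral_Icc_inv_sqrt_le {M : ℝ} (hM : 0 ≤ M) :
    ∫⁻ y in Set.Icc (-M) M, ENNReal.ofReal (√|y|)⁻¹ ≤ ENNReal.ofReal (4 * √M) := by
  have hneg : ∫⁻ y in Set.Ico (-M) 0, ENNReal.ofReal (√|y|)⁻¹ =
      ∫⁻ y in Set.Ioc 0 M, ENNReal.ofReal (√|y|)⁻¹ := by
    rw [← lintegral_indicator measurableSet_Ico, ← lintegral_indicator measurableSet_Ioc,
      ← lintegral_neg_eq_self]
    congr 1
    ext y
    simp only [Set.indicator, Set.mem_Ico, Set.mem_Ioc, abs_neg, neg_le_neg_iff,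
      Left.neg_neg_iff, and_comm]
  have hsub : Set.Icc (-M) M ⊆ (Set.Ico (-M) 0 ∪ Set.Ioc 0 M) ∪ {0} := by
    intro y hy
    rcases lt_trichotomy y 0 with h | h | h
    · exact Or.inl (Or.inl ⟨hy.1, h⟩)
    · exact Or.inr h
    · exact Or.inl (Or.inr ⟨h, hy.2⟩)
  calc ∫⁻ y in Set.Icc (-M) M, ENNReal.ofReal (√|y|)⁻¹
      ≤ ∫⁻ y in (Set.Ico (-M) 0 ∪ Set.Ioc 0 M) ∪ {0}, ENNReal.ofReal (√|y|)⁻¹ :=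
        lintegral_mono_set hsub
    _ ≤ (∫⁻ y in Set.Ico (-M) 0 ∪ Set.Ioc 0 M, ENNReal.ofReal (√|y|)⁻¹) +
        ∫⁻ y in ({0} : Set ℝ), ENNReal.ofReal (√|y|)⁻¹ := lintegral_union_le _ _ _
    _ ≤ ENNReal.ofReal (2 * √M) + ENNReal.ofReal (2 * √M) + 0 := by
        refine add_le_add ((lintegral_union_le _ _ _).trans ?_) (by simp)
        rw [hneg, lintegral_Ioc_inv_sqrt hM]
    _ = ENNReal.ofReal (4 * √M) := by
        rw [add_zero, ← ENNReal.ofReal_add (by positivity) (by positivity)]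
        congr 1; ring

lemma lintegral_Ico_inv_sqrt_le {a b : ℝ} (hab : a < b) :
    ∫⁻ y in Set.Ico a b, ENNReal.ofReal (√|y|)⁻¹ ≤
      ENNReal.ofReal (8 * (b - a) * (√(max |a| |b|))⁻¹) := by
  set M := max |a| |b| with hMdef
  have haM : |a| ≤ M := le_max_left _ _
  have hbM : |b| ≤ M := le_max_right _ _
  have hM : 0 < M := by
    by_contra! hM
    have h1 := abs_le.1 (haM.trans hM)
    have h2 := abs_le.1 (hbM.trans hM)
    linarith
  have hsq : √M * √M = M := Real.mul_self_sqrt hM.le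
  have hsq0 : 0 < √M := Real.sqrt_pos.2 hM
  rcases le_total (M / 2) (b - a) with h | h
  · refine (lintegral_mono_set fun y hy => ?_).trans
      ((lintegral_Icc_inv_sqrt_le hM.le).trans (ENNReal.ofReal_le_ofReal ?_))
    · exact ⟨(abs_le.1 haM).1.trans hy.1, hy.2.le.trans (abs_le.1 hbM).2⟩
    · rw [← div_eq_mul_inv, le_div_iff₀ hsq0]
      nlinarith
  · have hpt : ∀ y ∈ Set.Ico a b, ENNReal.ofReal (√|y|)⁻¹ ≤ ENNReal.ofReal (8 * (√M)⁻¹) := by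
      intro y hy
      refine ENNReal.ofReal_le_ofReal ?_
      have hy2 : M / 4 ≤ |y| := by
        have h1 := le_abs_self y
        have h2 := neg_abs_le y
        have hy1 := hy.1
        have hy3 := hy.2
        rcases max_choice |a| |b| with e | e <;> rw [← hMdef] at e <;>
          rcases abs_choice a with ea | ea <;> rcases abs_choice b with eb | eb <;>
          linarith
      have h8 : √M / 8 ≤ √|y| := by
        refine Real.le_sqrt_of_sq_le ?_
        nlinarith
      calc (√|y|)⁻¹ ≤ (√M / 8)⁻¹ := by gcongr
        _ = 8 * (√M)⁻¹ := by rw [inv_div, div_eq_mul_inv]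
    refine (setLIntegral_mono' measurableSet_Ico hpt).trans ?_
    rw [setLIntegral_const, Real.volume_Ico, ← ENNReal.ofReal_mul (by positivity)]
    exact ENNReal.ofReal_le_ofReal (le_of_eq (by ring))

lemma lavg_singWeight_le {a b x : ℝ} (hx : x ∈ Set.Ico a b) (hx0 : x ≠ 0)
    {K : ℝ} (hK : 0 ≤ K) :
    lavg volume (Set.Ico a b)
      (fun y => ENNReal.ofReal (K * (1 + singWeight y / singWeight x))) ≤
      ENNReal.ofReal (9 * K) := by
  have hab : a < b := hx.1.trans_lt hx.2
  have hv := singWeight_pos x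
  have hxM : |x| ≤ max |a| |b| := abs_le_max_abs_abs hx.1 hx.2.le
  have hvx : 1 + (√(max |a| |b|))⁻¹ ≤ singWeight x := by
    unfold singWeight
    have : 0 < √|x| := Real.sqrt_pos.2 (abs_pos.2 hx0)
    gcongr
  have hsplit : ∀ y, ENNReal.ofReal (K * (1 + singWeight y / singWeight x)) =
      ENNReal.ofReal (K * (1 + 1 / singWeight x)) +
        ENNReal.ofReal (K / singWeight x) * ENNReal.ofReal (√|y|)⁻¹ := by
    intro y
    rw [← ENNReal.ofReal_mul (by positivity),
      ← ENNReal.ofReal_add (by positivity) (by positivity)]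
    congr 1
    conv_lhs => rw [show singWeight y = 1 + (√|y|)⁻¹ from rfl]
    ring
  have hmeas : Measurable fun y : ℝ => ENNReal.ofReal (√|y|)⁻¹ :=
    (Real.continuous_sqrt.measurable.comp measurable_norm).inv.ennreal_ofReal
  simp_rw [lavg, hsplit]
  rw [lintegral_add_left measurable_const, lintegral_const_mul _ hmeas, setLIntegral_const,
    Real.volume_Ico, mul_comm, ← div_eq_mul_inv,
    ENNReal.div_le_iff (by simpa using hab) ENNReal.ofReal_ne_top,
    ← ENNReal.ofReal_mul (by positivity), ← ENNReal.ofReal_mul (by positivity)]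
  refine (add_le_add_right (mul_le_mul_right (lintegral_Ico_inv_sqrt_le hab) _) _).trans ?_
  have hba : 0 < b - a := sub_pos.2 hab
  set g := (√(max |a| |b|))⁻¹ with hg
  have hg0 : 0 ≤ g := by positivity
  rw [← ENNReal.ofReal_mul (by positivity),
      ← ENNReal.ofReal_add (by positivity) (by positivity)]
  refine ENNReal.ofReal_le_ofReal ?_
  calc K * (1 + 1 / singWeight x) * (b - a) + K / singWeight x * (8 * (b - a) * g)
      = K * (b - a) * (1 + (1 + 8 * g) / singWeight x) := by
        field_simp
        ring
    _ ≤ K * (b - a) * (1 + 8) := by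
        gcongr
        rw [div_le_iff₀ hv]
        linarith
    _ = 9 * K * (b - a) := by ring

lemma matAtInfty_tiltedWeight_lt_top {s t : ℝ} (hs : 1 ≤ s) (hst : s < t) :
    matAtInfty volume intervalsR (tiltedWeight s) t < ⊤ := by
  obtain ⟨K, hK0, hK⟩ := exists_specNorm_rpow_le hs hst
  have ht0 : 0 < t := by linarith
  refine (iSup₂_le ?_ : _ ≤ ENNReal.ofReal (9 * K)).trans_lt ENNReal.ofReal_lt_top
  rintro Q ⟨a, b, -, rfl⟩
  refine essSup_le_of_ae_le _ ?_
  have hne : ∀ᵐ x ∂(volume.restrict (Set.Ico a b)), x ≠ 0 :=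
    ae_restrict_of_ae (Measure.ae_ne volume 0)
  filter_upwards [hne, ae_restrict_mem measurableSet_Ico] with x hx0 hx
  refine le_trans ?_ (lavg_singWeight_le hx hx0 hK0)
  refine mul_le_mul_right (lintegral_mono fun y => ?_) _
  rw [ENNReal.ofReal_rpow_of_nonneg (specNorm_nonneg _) ht0.le]
  exact ENNReal.ofReal_le_ofReal (hK x y)

lemma mul_abs_sub_le_specNorm {a b c u c' u' : ℝ} (hb : 0 ≤ b)
    (h : c ^ 2 + u ^ 2 = 1) (h' : c' ^ 2 + u' ^ 2 = 1) :
    b * |c * u' - u * c'| ≤ specNorm ((stretch a c u * stretch b c' u').map Complex.ofReal) := by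
  have key := abs_bilin_le_specNorm (stretch a c u * stretch b c' u')
    (e := ![-u, c]) (f := ![c', u']) (by simp; linarith) (by simpa using h')
  refine le_trans (le_of_eq ?_) key
  have e : b * |c * u' - u * c'| =
      |b * (c ^ 2 + u ^ 2) * (c' ^ 2 + u' ^ 2) * (c * u' - u * c')| := by
    rw [h, h', mul_one, mul_one, abs_mul, abs_of_nonneg hb]
  rw [e, stretch_eq h, stretch_eq h']
  congr 1
  simp [Matrix.mul_apply, Fin.sum_univ_two]
  ring

lemma tendsto_tilt {s : ℝ} (hs : 1 ≤ s) :
    Filter.Tendsto (tilt s) (nhdsWithin 0 (Set.Ioi 0)) (nhds 0) := by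
  have hs0 : 0 < 1 / s := by positivity
  have hv : Filter.Tendsto singWeight (nhdsWithin 0 (Set.Ioi 0)) Filter.atTop := by
    refine Filter.tendsto_atTop_add_const_left _ 1 (tendsto_inv_nhdsGT_zero.comp ?_)
    refine tendsto_nhdsWithin_iff.2 ⟨?_, ?_⟩
    · have : Continuous fun x : ℝ => √|x| := by fun_prop
      simpa using (this.tendsto 0).mono_left nhdsWithin_le_nhds
    · filter_upwards [self_mem_nhdsWithin] with x hx
      exact Real.sqrt_pos.2 (abs_pos.2 (ne_of_gt hx))
  have hlog : Filter.Tendsto (fun v : ℝ => (1 + Real.log v) / v) Filter.atTop (nhds 0) := by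
    have h1 := Real.isLittleO_log_id_atTop.tendsto_div_nhds_zero
    simpa [add_div] using tendsto_inv_atTop_zero.add h1
  have := (hlog.comp hv).rpow_const (p := 1 / s) (Or.inr hs0.le)
  rwa [Real.zero_rpow hs0.ne'] at this

lemma le_specNorm_rpow {s x y : ℝ} (hs : 1 ≤ s) (hx : tilt s x ≤ 1 / 4)
    (hxy : tilt s x ≤ tilt s y / 4) :
    (1 / 2) ^ s * (1 + Real.log (singWeight y)) ≤
      specNorm (matRpow (tiltedWeight s x) (1 / s) * matRpow (tiltedWeight s y) (-(1 / s)))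
        ^ s := by
  have hs0 : 0 < s := by linarith
  have hy := singWeight_pos y
  have hux := tilt_nonneg s x
  have huy := tilt_nonneg s y
  have hcx : 3 / 4 ≤ √(1 - tilt s x ^ 2) := Real.le_sqrt_of_sq_le (by nlinarith)
  have hcy : √(1 - tilt s y ^ 2) ≤ 1 := Real.sqrt_le_one.2 (by nlinarith)
  have hS : 1 / 2 * tilt s y ≤
      |√(1 - tilt s x ^ 2) * tilt s y - tilt s x * √(1 - tilt s y ^ 2)| := by
    refine le_trans ?_ (le_abs_self _)
    nlinarith [mul_le_mul_of_nonneg_left hcy hux, mul_le_mul_of_nonneg_right hcx huy]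
  have key : singWeight y ^ (1 / s) * (1 / 2 * tilt s y) ≤
      specNorm (matRpow (tiltedWeight s x) (1 / s) *
        matRpow (tiltedWeight s y) (-(1 / s))) := by
    rw [matRpow_tiltedWeight_mul hs]
    exact (mul_le_mul_of_nonneg_left hS (by positivity)).trans
      (mul_abs_sub_le_specNorm (by positivity) (cos_sq_add_tilt_sq hs x) (cos_sq_add_tilt_sq hs y))
  refine le_trans (le_of_eq ?_) (Real.rpow_le_rpow (by positivity) key hs0.le)
  rw [← singWeight_mul_tilt_rpow hs, Real.mul_rpow (by positivity) (by positivity),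
    Real.mul_rpow (by positivity) huy, ← Real.rpow_mul hy.le, one_div_mul_cancel hs0.ne',
    Real.rpow_one]
  ring

lemma le_tilt {s y δ : ℝ} (hs : 1 ≤ s) (hδ : 0 < δ) (hy : δ ≤ y) :
    (1 / singWeight δ) ^ (1 / s) ≤ tilt s y := by
  have hv := singWeight_pos y
  have h1 := log_singWeight_nonneg y
  have hle : singWeight y ≤ singWeight δ := by
    unfold singWeight
    have : 0 < √|δ| := Real.sqrt_pos.2 (abs_pos.2 hδ.ne')
    gcongr
  have hvδ := singWeight_pos δ
  unfold tilt
  gcongr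
  linarith

lemma le_log_singWeight {y : ℝ} {n : ℕ} (hy : 0 < y) (hyn : y ≤ 2 ^ (-(n : ℤ))) :
    (n : ℝ) / 4 ≤ Real.log (singWeight y) := by
  have hsq : 0 < √|y| := Real.sqrt_pos.2 (abs_pos.2 hy.ne')
  calc (n : ℝ) / 4 ≤ n / 2 * Real.log 2 := by
        have := Real.log_two_gt_d9
        nlinarith [(Nat.cast_nonneg n : (0 : ℝ) ≤ n)]
    _ = -(Real.log (2 ^ (-(n : ℤ))) / 2) := by
        rw [Real.log_zpow]; push_cast; ring
    _ ≤ -(Real.log y / 2) := by gcongr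
    _ = Real.log (√|y|)⁻¹ := by
        rw [Real.log_inv, abs_of_pos hy, Real.log_sqrt hy.le]
    _ ≤ Real.log (singWeight y) := by
        refine Real.log_le_log (inv_pos.2 hsq) ?_
        unfold singWeight; linarith

lemma le_matAtInfty_tiltedWeight {s : ℝ} (hs : 1 ≤ s) (n : ℕ) :
    ENNReal.ofReal ((1 / 2) ^ s * n / 8) ≤
      matAtInfty volume dyadicsR (tiltedWeight s) s := by
  have hs0 : 0 < s := by linarith
  set δ : ℝ := 2 ^ (-(n : ℤ)) with hδdef
  have hδ : 0 < δ := by positivity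
  have hQ : Set.Ico 0 δ ∈ dyadicsR := ⟨0, -(n : ℤ), by simp [hδdef]⟩
  refine le_trans ?_ (le_iSup₂_of_le (Set.Ico 0 δ) hQ le_rfl)
  set F : ℝ → ℝ≥0∞ := fun x => lavg volume (Set.Ico 0 δ) fun y =>
    ENNReal.ofReal (specNorm (matRpow (tiltedWeight s x) (1 / s) *
      matRpow (tiltedWeight s y) (-(1 / s)))) ^ s with hF
  set η : ℝ := min 1 ((1 / singWeight (δ / 2)) ^ (1 / s)) / 4 with hη
  have hη0 : 0 < η := by
    have := singWeight_pos (δ / 2)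
    positivity
  obtain ⟨ρ, hρ0, hρ⟩ := mem_nhdsGT_iff_exists_Ioo_subset.1
    ((tendsto_tilt hs).eventually_lt_const hη0)
  have hρ0' : (0 : ℝ) < ρ := hρ0
  have hlow : ∀ x ∈ Set.Ioo 0 (min ρ δ), ENNReal.ofReal ((1 / 2) ^ s * n / 8) ≤ F x := by
    intro x hx
    have hxη : tilt s x < η := hρ ⟨hx.1, hx.2.trans_le (min_le_left _ _)⟩
    have hpt : ∀ y ∈ Set.Ico (δ / 2) δ, ENNReal.ofReal ((1 / 2) ^ s * n / 4) ≤
        ENNReal.ofReal (specNorm (matRpow (tiltedWeight s x) (1 / s) *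
          matRpow (tiltedWeight s y) (-(1 / s)))) ^ s := by
      intro y hy
      rw [ENNReal.ofReal_rpow_of_nonneg (specNorm_nonneg _) hs0.le]
      refine ENNReal.ofReal_le_ofReal (le_trans ?_ (le_specNorm_rpow hs ?_ ?_))
      · have hl := le_log_singWeight (n := n) (by linarith [hy.1]) hy.2.le
        rw [mul_div_assoc]
        gcongr
        linarith
      · linarith [min_le_left 1 ((1 / singWeight (δ / 2)) ^ (1 / s))]
      · linarith [min_le_right 1 ((1 / singWeight (δ / 2)) ^ (1 / s)),
          le_tilt hs (half_pos hδ) hy.1]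
    have hsub : Set.Ico (δ / 2) δ ⊆ Set.Ico 0 δ := Set.Ico_subset_Ico_left (by positivity)
    have hint := (setLIntegral_mono' (μ := volume) measurableSet_Ico hpt).trans
      (lintegral_mono_set hsub)
    rw [setLIntegral_const, Real.volume_Ico, ← ENNReal.ofReal_mul (by positivity)] at hint
    rw [hF]
    simp only [lavg]
    rw [mul_comm (volume _)⁻¹, ← div_eq_mul_inv, Real.volume_Ico, sub_zero,
      ENNReal.le_div_iff_mul_le (Or.inl (by simpa using hδ)) (Or.inl ENNReal.ofReal_ne_top),
      ← ENNReal.ofReal_mul (by positivity)]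
    exact le_trans (le_of_eq (by congr 1; ring)) hint
  have hsub : Set.Ioo 0 (min ρ δ) ⊆ Set.Ico 0 δ := fun x hx =>
    ⟨hx.1.le, hx.2.trans_le (min_le_right _ _)⟩
  have hae := ae_restrict_of_ae_restrict_of_subset hsub
    (ENNReal.ae_le_essSup (μ := volume.restrict (Set.Ico 0 δ)) F)
  have : (ae (volume.restrict (Set.Ioo 0 (min ρ δ)))).NeBot := by
    rw [ae_neBot, Ne, Measure.restrict_eq_zero, Real.volume_Ioo]
    simp [hρ0', hδ]
  obtain ⟨x, hx, hxQ⟩ := (hae.and (ae_restrict_mem measurableSet_Ioo)).exists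
  exact (hlow x hxQ).trans hx

lemma matAtInfty_tiltedWeight_eq_top {s : ℝ} (hs : 1 ≤ s) :
    matAtInfty volume dyadicsR (tiltedWeight s) s = ⊤ := by
  refine ENNReal.eq_top_of_forall_nnreal_le fun r => ?_
  have hc : (0 : ℝ) < (1 / 2) ^ s / 8 := by positivity
  obtain ⟨n, hn⟩ := exists_nat_ge ((r : ℝ) / ((1 / 2) ^ s / 8))
  refine le_trans ?_ (le_matAtInfty_tiltedWeight hs n)
  rw [← ENNReal.ofReal_coe_nnreal]
  refine ENNReal.ofReal_le_ofReal ?_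
  rw [div_le_iff₀ hc] at hn
  linarith

theorem statement7 (s : ℝ) (hs : 1 ≤ s) :
    ∃ W : ℝ → Matrix (Fin 2) (Fin 2) ℂ,
      IsMatrixWeight (volume : Measure ℝ) W ∧
      matAtInfty volume dyadicsR W s = ⊤ ∧
      ∀ t : ℝ, s < t → matAtInfty volume intervalsR W t < ⊤ := by
  exact ⟨tiltedWeight s, isMatrixWeight_tiltedWeight hs, matAtInfty_tiltedWeight_eq_top hs,
    fun _ => matAtInfty_tiltedWeight_lt_top hs⟩

end
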